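/- In a bundle Υ = (Θ,→), if node n₀ precedes a transmission node n₂ (i.e., n₀ ≺ n₂ and evt(n₂) is a transmission), then either n₀ and n₂ lie on the same strand, or there is a reception node n₁ on the same strand as n₂ and strictly earlier on that strand than n₂ (i.e., n₁ = (s,j) and n₂ = (s,i) with j < i and evt(n₁) a reception) such that n₀ precedes n₁ (n₀ ≺ n₁). -/

import Mathlib

/-- The four sorts of the Simple Crypto Algebra signature. -/
inductive MSort : Type
  | top | A | S | D
deriving DecidableEq

/-- Message terms over a set `V` of variables (the free order-sorted algebra
in canonical form; ground messages are `MTerm Empty`). -/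
inductive MTerm (V : Type) : Type
  | var (v : V)
  | akey (i : ℕ) (b : Bool)   -- asymmetric key constants: `a_i` when `b = false`, `b_i` when `b = true`
  | skey (i : ℕ)              -- symmetric key constants `s_i`
  | data (i : ℕ)              -- data constants
  | invk (t : MTerm V)        -- key inverse (kept only where it cannot be reduced)
  | pair (t₀ t₁ : MTerm V)
  | enc (t k : MTerm V)

namespace MTerm

/-- The sort of a term (`none` when ill-sorted), given variable sorts `so`. -/
def srt {V : Type} (so : V → MSort) : MTerm V → Option MSort
  | var v => some (so v)
  | akey _ _ => some .A
  | skey _ => some .S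
  | data _ => some .D
  | invk t => match t.srt so with
      | some .A => some .A
      | some .S => some .S
      | _ => none
  | pair t₀ t₁ => match t₀.srt so, t₁.srt so with
      | some _, some _ => some .top
      | _, _ => none
  | enc t k => match t.srt so, k.srt so with
      | some _, some .A => some .top
      | some _, some .S => some .top
      | _, _ => none

/-- The key-inverse operation on canonical terms. -/
def invOp {V : Type} (so : V → MSort) : MTerm V → MTerm V
  | var v => if so v = .S then var v else invk (var v)
  | akey i b => akey i (!b)
  | skey i => skey i
  | invk t => t
  | t => invk t

/-- Apply a substitution (an algebra homomorphism determined by its action on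
variables), normalizing inverses; `so'` gives the sorts of target variables. -/
def subst {V W : Type} (so' : W → MSort) (σ : V → MTerm W) : MTerm V → MTerm W
  | var v => σ v
  | akey i b => akey i b
  | skey i => skey i
  | data i => data i
  | invk t => invOp so' (t.subst so' σ)
  | pair t₀ t₁ => pair (t₀.subst so' σ) (t₁.subst so' σ)
  | enc t k => enc (t.subst so' σ) (k.subst so' σ)

end MTerm

/-- Subsort relation: every sort is ≤ itself and ≤ ⊤. -/
def SLe (s₁ s₂ : MSort) : Prop := s₁ = s₂ ∨ s₂ = .top

/-- `t` is a message of sort `s` (up to subsorting). -/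
def HasSort {V : Type} (so : V → MSort) (t : MTerm V) (s : MSort) : Prop :=
  ∃ s', t.srt so = some s' ∧ SLe s' s

def WellSorted {V : Type} (so : V → MSort) (t : MTerm V) : Prop :=
  (t.srt so).isSome = true

/-- Atoms are the messages of sort A, S or D. -/
def IsAtomM {V : Type} (so : V → MSort) (t : MTerm V) : Prop :=
  t.srt so = some .A ∨ t.srt so = some .S ∨ t.srt so = some .D

/-- Sorting of ground (variable-free) terms. -/
def gSo : Empty → MSort := fun e => nomatch e

/-- Ground messages: the initial algebra. -/
abbrev Msg := MTerm Empty

/-- The carried-by relation `t₀ ⊑ t₁`. -/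
inductive Carries {V : Type} : MTerm V → MTerm V → Prop
  | refl (t) : Carries t t
  | pairL {t t₀ t₁} : Carries t t₀ → Carries t (.pair t₀ t₁)
  | pairR {t t₀ t₁} : Carries t t₁ → Carries t (.pair t₀ t₁)
  | encP {t t₀ k} : Carries t t₀ → Carries t (.enc t₀ k)
/-- Events: transmission `+t` or reception `−t`. -/
inductive EvtT (V : Type) : Type
  | send (t : MTerm V)
  | recv (t : MTerm V)

namespace EvtT

def msg {V : Type} : EvtT V → MTerm V
  | send t => t
  | recv t => t

def IsSend {V : Type} : EvtT V → Prop
  | send _ => True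
  | recv _ => False

def IsRecv {V : Type} : EvtT V → Prop
  | send _ => False
  | recv _ => True

def subst {V W : Type} (so' : W → MSort) (σ : V → MTerm W) : EvtT V → EvtT W
  | send t => send (t.subst so' σ)
  | recv t => recv (t.subst so' σ)

end EvtT

/-- A default event (used only for out-of-range indexing). -/
def dEvt {V : Type} : EvtT V := .send (.data 0)

/-- A strand space: a finite non-empty sequence of traces (finite non-empty
sequences of events); strands are indices into the sequence. -/
structure SSpaceT (V : Type) where
  tr : List (List (EvtT V))
  nonnil : tr ≠ []
  ne : ∀ C ∈ tr, C ≠ []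

namespace SSpaceT

variable {V : Type}

/-- The trace of strand `s`. -/
def trace (Θ : SSpaceT V) (s : ℕ) : List (EvtT V) := Θ.tr.getD s []

/-- `s` is a strand of `Θ`, i.e. a member of `Dom(Θ)`. -/
def IsStrand (Θ : SSpaceT V) (s : ℕ) : Prop := s < Θ.tr.length

/-- `n = (s, i)` is a node of `Θ`. -/
def IsNode (Θ : SSpaceT V) (n : ℕ × ℕ) : Prop :=
  n.1 < Θ.tr.length ∧ n.2 < (Θ.trace n.1).length

/-- The event at node `n`. -/
def evt (Θ : SSpaceT V) (n : ℕ × ℕ) : EvtT V := (Θ.trace n.1).getD n.2 dEvt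

end SSpaceT

/-- `t` originates in trace `C` at index `i`. -/
def OrigAt {V : Type} (C : List (EvtT V)) (t : MTerm V) (i : ℕ) : Prop :=
  i < C.length ∧ (C.getD i dEvt).IsSend ∧ Carries t (C.getD i dEvt).msg ∧
    ∀ j < i, ¬ Carries t (C.getD j dEvt).msg

/-- `t` is non-originating in `Θ`. -/
def SSpaceT.Non {V : Type} (Θ : SSpaceT V) (t : MTerm V) : Prop :=
  ∀ s, Θ.IsStrand s → ∀ i, ¬ OrigAt (Θ.trace s) t i

/-- `t` uniquely originates in `Θ` at node `n`. -/
def SSpaceT.Uniq {V : Type} (Θ : SSpaceT V) (t : MTerm V) (n : ℕ × ℕ) : Prop :=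
  Θ.IsStrand n.1 ∧ OrigAt (Θ.trace n.1) t n.2 ∧
    ∀ s i, Θ.IsStrand s → OrigAt (Θ.trace s) t i → s = n.1 ∧ i = n.2

/-- Strand succession edges `(s, i) ⇒ (s, i+1)`. -/
def SuccEdge {V : Type} (Θ : SSpaceT V) (n₀ n₁ : ℕ × ℕ) : Prop :=
  n₀.1 = n₁.1 ∧ n₁.2 = n₀.2 + 1 ∧ Θ.IsNode n₁

/-- A bundle: a ground strand space together with communication edges forming,
with the strand-succession edges, a finite directed acyclic graph in which
every reception has a unique matching transmission. -/
structure Bundle where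
  Θ : SSpaceT Empty
  comm : (ℕ × ℕ) → (ℕ × ℕ) → Prop
  comm_nodes : ∀ n₀ n₁, comm n₀ n₁ → Θ.IsNode n₀ ∧ Θ.IsNode n₁
  comm_evt : ∀ n₀ n₁, comm n₀ n₁ → ∃ t, Θ.evt n₀ = .send t ∧ Θ.evt n₁ = .recv t
  comm_uniq : ∀ n₁, Θ.IsNode n₁ → (Θ.evt n₁).IsRecv → ∃! n₀, comm n₀ n₁
  acyclic : ∀ n, ¬ Relation.TransGen (fun m₀ m₁ => SuccEdge Θ m₀ m₁ ∨ comm m₀ m₁) n n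

/-- The edge relation of a bundle. -/
def Bundle.edge (Υ : Bundle) (n₀ n₁ : ℕ × ℕ) : Prop :=
  SuccEdge Υ.Θ n₀ n₁ ∨ Υ.comm n₀ n₁

/-- The precedes relation `≺` of a bundle: the transitive closure of the edges. -/
def Bundle.prec (Υ : Bundle) : (ℕ × ℕ) → (ℕ × ℕ) → Prop :=
  Relation.TransGen Υ.edge

/-- In a bundle `Υ = (Θ, →)`, if node `n₀` precedes a transmission node `n₂`,
then either `n₀` and `n₂` lie on the same strand, or there is a reception node
`n₁ = (n₂.1, j)` strictly earlier than `n₂` on the strand of `n₂` with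
`n₀ ≺ n₁`. -/
theorem prec_transmission (Υ : Bundle) (n₀ n₂ : ℕ × ℕ)
    (h₀ : Υ.Θ.IsNode n₀) (h₂ : Υ.Θ.IsNode n₂)
    (hprec : Υ.prec n₀ n₂) (hsend : (Υ.Θ.evt n₂).IsSend) :
    n₀.1 = n₂.1 ∨
      ∃ j : ℕ, j < n₂.2 ∧ (Υ.Θ.evt (n₂.1, j)).IsRecv ∧ Υ.prec n₀ (n₂.1, j) := by
  have key : ∀ n, Υ.prec n₀ n → n₀.1 = n.1 ∨
      ∃ j : ℕ, j ≤ n.2 ∧ (Υ.Θ.evt (n.1, j)).IsRecv ∧ Υ.prec n₀ (n.1, j) := by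
    have comm_case : ∀ m n, Υ.comm m n → (Υ.Θ.evt n).IsRecv := by
      intro m n h
      obtain ⟨t, _, ht⟩ := Υ.comm_evt m n h
      rw [ht]
      trivial
    intro n hn
    induction hn with
    | single h =>
      rcases h with h | h
      · exact Or.inl h.1
      · exact Or.inr ⟨_, le_refl _, comm_case _ _ h, Relation.TransGen.single (Or.inr h)⟩
    | tail hab h ih =>
      rcases h with h | h
      · obtain ⟨h1, h2, _⟩ := h
        rw [h1] at ih
        rcases ih with ih | ⟨j, hj, hr, hp⟩
        · exact Or.inl ih
        · exact Or.inr ⟨j, by omega, hr, hp⟩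
      · exact Or.inr ⟨_, le_refl _, comm_case _ _ h, Relation.TransGen.tail hab (Or.inr h)⟩
  rcases key n₂ hprec with h | ⟨j, hj, hr, hp⟩
  · exact Or.inl h
  · refine Or.inr ⟨j, lt_of_le_of_ne hj ?_, hr, hp⟩
    rintro rfl
    change (Υ.Θ.evt n₂).IsRecv at hr
    cases he : Υ.Θ.evt n₂ with
    | send t => rw [he] at hr; exact hr
    | recv t => rw [he] at hsend; exact hsend
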